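/- arXiv:2007.08811 — 5 statements merged into one kernel-verified Lean document; each statement's English description precedes it below -/
import Mathlib

section
/- Let G = (V,E) be a finite nonempty simple graph in which any two vertices lying in the same connected component are at distance at most d, and let k ≥ d. Then G admits a burning sequence of length k if and only if there exists a function b : {0,…,d−1} → V such that the number of connected components of G that are not entirely contained in the union ⋃_{0 ≤ i ≤ d−1} N_i[b_i] is at most k − d. -/
/-- The closed ball of radius `i` around `v`: vertices reachable from `v` by a
walk of length at most `i`. -/
def burnBall {V : Type*} (G : SimpleGraph V) (v : V) (i : ℕ) : Set V :=
  {w | ∃ p : G.Walk v w, p.length ≤ i}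

/-- `b : Fin k → V` is a burning sequence of length `k` for `G`. -/
def IsBurningSeq {V : Type*} (G : SimpleGraph V) {k : ℕ} (b : Fin k → V) : Prop :=
  ∀ v : V, ∃ i : Fin k, v ∈ burnBall G (b i) (i : ℕ)

/-- Let `G` be a finite nonempty graph in which any two vertices in the same connected
component are at distance at most `d`, and let `k ≥ d`.  Then `G` has a burning sequence
of length `k` iff there is `b : Fin d → V` such that the number of connected components
not entirely contained in `⋃ i, N_i[b i]` is at most `k - d`. -/
theorem burning_iff_few_unburned_components {V : Type*} [Fintype V] [Nonempty V]
    (G : SimpleGraph V) (d k : ℕ)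
    (hdiam : ∀ u v : V, G.Reachable u v → ∃ p : G.Walk u v, p.length ≤ d)
    (hdk : d ≤ k) :
    (∃ b : Fin k → V, IsBurningSeq G b) ↔
      ∃ b : Fin d → V,
        Nat.card {C : G.ConnectedComponent |
          ¬ (C.supp ⊆ ⋃ i : Fin d, burnBall G (b i) (i : ℕ))} ≤ k - d := by
  constructor
  · rintro ⟨b, hb⟩
    refine ⟨fun i => b (Fin.castLE hdk i), ?_⟩
    let late : Fin (k - d) → G.ConnectedComponent := fun j =>
      G.connectedComponentMk (b ⟨d + j, by omega⟩)
    have hsub : {C : G.ConnectedComponent | ¬ (C.supp ⊆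
        ⋃ i : Fin d, burnBall G (b (Fin.castLE hdk i)) (i : ℕ))} ⊆ Set.range late := by
      intro C hC
      obtain ⟨v, hvC, hv⟩ := Set.not_subset.mp hC
      obtain ⟨i, p, hp⟩ := hb v
      have hdi : d ≤ i := by
        by_contra! hlt
        exact hv (Set.mem_iUnion.mpr ⟨⟨i, hlt⟩, p, hp⟩)
      refine ⟨⟨i - d, by omega⟩, ?_⟩
      have hi : (⟨d + (i - d), by omega⟩ : Fin k) = i := Fin.ext (by simp; omega)
      rw [SimpleGraph.ConnectedComponent.mem_supp_iff] at hvC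
      simp only [late, hi, ← hvC]
      exact SimpleGraph.ConnectedComponent.sound p.reachable
    calc _ ≤ Nat.card (Set.range late) := Nat.card_mono (Set.finite_range late) hsub
      _ ≤ Nat.card (Fin (k - d)) := Finite.card_range_le late
      _ = k - d := Nat.card_fin _
  · rintro ⟨b, hb⟩
    set S := {C : G.ConnectedComponent |
      ¬ (C.supp ⊆ ⋃ i : Fin d, burnBall G (b i) (i : ℕ))}
    let e : S ↪ Fin (k - d) :=
      (Finite.equivFin S).toEmbedding.trans (Fin.castLEEmb hb)
    choose r hr using fun C : S => C.1.exists_rep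
    let late : Fin (k - d) → V := Function.extend e r fun _ => Classical.arbitrary V
    refine ⟨fun i => if h : (i : ℕ) < d then b ⟨i, h⟩ else late ⟨i - d, by omega⟩, ?_⟩
    intro v
    by_cases hC : G.connectedComponentMk v ∈ S
    · have hre : late (e ⟨_, hC⟩) = r ⟨_, hC⟩ := e.injective.extend_apply _ _ _
      obtain ⟨p, hp⟩ := hdiam (r ⟨_, hC⟩) v
        (SimpleGraph.ConnectedComponent.exact (hr ⟨_, hC⟩))
      refine ⟨⟨d + e ⟨_, hC⟩, by omega⟩, ?_⟩
      simp only [add_lt_iff_neg_left, not_lt_zero, dite_false, add_tsub_cancel_left,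
        Fin.eta, hre]
      exact ⟨p, by omega⟩
    · obtain ⟨i, hi⟩ := Set.mem_iUnion.mp (not_not.mp hC
        (SimpleGraph.ConnectedComponent.mem_supp_iff _ _ |>.mpr rfl))
      exact ⟨Fin.castLE hdk i, by simpa using hi⟩
end

section
/- Let G = (V,E) be a finite nonempty simple graph with exactly p connected components C_1,…,C_p, in which any two vertices lying in the same connected component are at distance at most d, and let k be an integer with p ≤ k and d ≤ k. Then G admits a burning sequence of length k if and only if there exist a subfamily 𝒞 of connected components with |𝒞| ≥ p − (k − d), pairwise disjoint sets I_C ⊆ {0,…,d−1} indexed by C ∈ 𝒞, and vertices b_i^C ∈ C for each C ∈ 𝒞 and i ∈ I_C, such that for every C ∈ 𝒞 every vertex of C lies in ⋃_{i ∈ I_C} N_i[b_i^C]. -/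
/-- Let `G` be a finite nonempty graph with exactly `p` connected components, in which any
two vertices in a common component are at distance at most `d`, and let `p ≤ k`, `d ≤ k`.
Then `G` has a burning sequence of length `k` iff there are a family `𝒞` of components
with `|𝒞| ≥ p - (k - d)`, pairwise disjoint index sets `I C ⊆ {0, …, d-1}` and vertices
`b C i ∈ C` such that every vertex of each `C ∈ 𝒞` lies in `⋃ i ∈ I C, N_i[b C i]`. -/
theorem burning_iff_disjoint_sets {V : Type*} [Fintype V] [Nonempty V]
    (G : SimpleGraph V) (d k p : ℕ)
    (hp : Nat.card G.ConnectedComponent = p)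
    (hdiam : ∀ u v : V, G.Reachable u v → ∃ q : G.Walk u v, q.length ≤ d)
    (hpk : p ≤ k) (hdk : d ≤ k) :
    (∃ b : Fin k → V, IsBurningSeq G b) ↔
      ∃ (𝒞 : Set G.ConnectedComponent) (I : G.ConnectedComponent → Set ℕ)
        (b : G.ConnectedComponent → ℕ → V),
        p - (k - d) ≤ Nat.card 𝒞 ∧
        (∀ C ∈ 𝒞, I C ⊆ Set.Iio d) ∧
        (𝒞.Pairwise fun C C' => Disjoint (I C) (I C')) ∧
        (∀ C ∈ 𝒞, ∀ i ∈ I C, b C i ∈ C.supp) ∧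
        (∀ C ∈ 𝒞, C.supp ⊆ ⋃ i ∈ I C, burnBall G (b C i) i) := by
  classical
  have hcompl (𝒞 : Set G.ConnectedComponent) : 𝒞.ncard + 𝒞ᶜ.ncard = p :=
    hp ▸ Set.ncard_add_ncard_compl 𝒞
  constructor
  · rintro ⟨b, hb⟩
    let 𝒟 : Set G.ConnectedComponent :=
      Set.range fun j : Fin (k - d) => G.connectedComponentMk (b ⟨d + j, by omega⟩)
    have h𝒟 : 𝒟.ncard ≤ k - d := by
      have h := Set.ncard_image_le (f := fun j : Fin (k - d) =>
        G.connectedComponentMk (b ⟨d + j, by omega⟩)) (s := Set.univ) Set.finite_univ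
      rwa [Set.image_univ, Set.ncard_univ, Nat.card_fin] at h
    let b' : ℕ → V := fun i => if h : i < k then b ⟨i, h⟩ else Classical.arbitrary V
    have hb' (i : Fin k) : b' i = b i := by simp [b']
    refine ⟨𝒟ᶜ, fun C => {i | i < d ∧ b' i ∈ C.supp}, fun _ => b', ?_,
      fun C _ i hi => hi.1, ?_, fun C _ i hi => hi.2, ?_⟩
    · have := hcompl 𝒟
      rw [Nat.card_coe_set_eq]
      omega
    · intro C _ C' _ hne
      refine Set.disjoint_left.mpr fun i hi hi' => hne ?_
      exact hi.2.symm.trans hi'.2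
    · intro C hC v hv
      obtain ⟨i, q, hq⟩ := hb v
      have hi : b i ∈ C.supp :=
        (SimpleGraph.ConnectedComponent.sound q.reachable).trans hv
      have hid : (i : ℕ) < d := by
        by_contra hid
        refine hC ⟨⟨i - d, by omega⟩, ?_⟩
        have : (⟨d + (i - d), by omega⟩ : Fin k) = i := Fin.ext (by simp; omega)
        simp only [this]
        exact hi
      refine Set.mem_iUnion₂.mpr ⟨i, ⟨hid, by rwa [hb']⟩, ?_⟩
      simp only [hb']
      exact ⟨q, hq⟩
  · rintro ⟨𝒞, I, b, hcard, hI, hdisj, -, hcov⟩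
    have hle : Nat.card ↥𝒞ᶜ ≤ Nat.card (Fin (k - d)) := by
      have := hcompl 𝒞
      rw [Nat.card_coe_set_eq] at hcard ⊢
      rw [Nat.card_fin]
      omega
    obtain ⟨f⟩ : Nonempty (↥𝒞ᶜ ↪ Fin (k - d)) := by
      rw [Nat.card_eq_fintype_card, Nat.card_eq_fintype_card] at hle
      exact Function.Embedding.nonempty_of_card_le hle
    have hchoice (i : Fin k) : ∃ v, (∀ C ∈ 𝒞, (i : ℕ) ∈ I C → v = b C i) ∧
        ∀ C : ↥𝒞ᶜ, d + f C = i → v = C.1.out := by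
      by_cases h : ∃ C ∈ 𝒞, (i : ℕ) ∈ I C
      · obtain ⟨C, hC, hi⟩ := h
        refine ⟨b C i, fun C' hC' hi' => ?_, fun C' hC' => ?_⟩
        · rw [hdisj.eq hC hC' (Set.not_disjoint_iff.mpr ⟨i, hi, hi'⟩)]
        · have : (i : ℕ) < d := hI C hC hi
          omega
      · by_cases h' : ∃ C : ↥𝒞ᶜ, d + f C = i
        · obtain ⟨C, hC⟩ := h'
          refine ⟨C.1.out, fun C' hC' hi' => (h ⟨C', hC', hi'⟩).elim, fun C' hC' => ?_⟩
          rw [f.injective (Fin.ext (by omega) : f C = f C')]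
        · exact ⟨Classical.arbitrary V, fun C hC hi => (h ⟨C, hC, hi⟩).elim,
            fun C hC => (h' ⟨C, hC⟩).elim⟩
    choose g hg hg' using hchoice
    refine ⟨g, fun v => ?_⟩
    by_cases hv : G.connectedComponentMk v ∈ 𝒞
    · obtain ⟨i, hi, hvi⟩ := Set.mem_iUnion₂.mp (hcov _ hv rfl)
      have hid : i < d := hI _ hv hi
      refine ⟨⟨i, by omega⟩, ?_⟩
      rwa [hg ⟨i, by omega⟩ _ hv hi]
    · let C : ↥𝒞ᶜ := ⟨G.connectedComponentMk v, hv⟩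
      refine ⟨⟨d + f C, by omega⟩, ?_⟩
      rw [hg' ⟨d + f C, by omega⟩ C rfl]
      obtain ⟨q, hq⟩ := hdiam C.1.out v
        (SimpleGraph.ConnectedComponent.exact (Quot.out_eq C.1))
      exact ⟨q, hq.trans (Nat.le_add_right _ _)⟩
end

section
/- Let G = (V,E) be a finite simple graph and k ≥ 1 an integer. Consider the universe W = V ⊔ {0,…,k−1} (disjoint union) and the set family 𝒮 = { N_i[v] ∪ {i} : v ∈ V, i ∈ {0,…,k−1} } of subsets of W, where N_i[v] ⊆ V is included via the left injection and i via the right injection. Then G admits a burning sequence of length k if and only if there exists a subfamily 𝒮' ⊆ 𝒮 with |𝒮'| ≤ k whose union is all of W. -/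
/-- `G` admits a burning sequence of length `k ≥ 1` iff the Set Cover instance on the
universe `V ⊕ Fin k` with set family `{N_i[v] ∪ {i} : v ∈ V, i < k}` has a cover
consisting of at most `k` sets. -/
theorem burning_iff_setCover {V : Type*} [Fintype V] (G : SimpleGraph V)
    (k : ℕ) (hk : 1 ≤ k) :
    (∃ b : Fin k → V, IsBurningSeq G b) ↔
      ∃ 𝒮' : Set (Set (V ⊕ Fin k)),
        𝒮' ⊆ {A | ∃ (v : V) (i : Fin k),
                A = Sum.inl '' burnBall G v (i : ℕ) ∪ {Sum.inr i}} ∧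
        Nat.card 𝒮' ≤ k ∧
        ⋃₀ 𝒮' = Set.univ := by
  constructor
  · rintro ⟨b, hb⟩
    refine ⟨Set.range fun i : Fin k ↦ Sum.inl '' burnBall G (b i) (i : ℕ) ∪ {Sum.inr i},
      ?_, ?_, ?_⟩
    · rintro _ ⟨i, rfl⟩
      exact ⟨b i, i, rfl⟩
    · simpa using Finite.card_range_le
        fun i : Fin k ↦ (Sum.inl '' burnBall G (b i) (i : ℕ) ∪ {Sum.inr i} : Set (V ⊕ Fin k))
    · refine Set.eq_univ_of_forall ?_
      rintro (v | i)
      · obtain ⟨i, hi⟩ := hb v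
        exact ⟨_, ⟨i, rfl⟩, Or.inl ⟨v, hi, rfl⟩⟩
      · exact ⟨_, ⟨i, rfl⟩, Or.inr rfl⟩
  · rintro ⟨𝒮', hsub, hcard, hcover⟩
    have h_sets (i : Fin k) :
        ∃ v : V, Sum.inl '' burnBall G v (i : ℕ) ∪ {Sum.inr i} ∈ 𝒮' := by
      obtain ⟨A, hA, hi⟩ := hcover.symm ▸ Set.mem_univ (Sum.inr i : V ⊕ Fin k)
      obtain ⟨v, j, rfl⟩ := hsub hA
      obtain rfl : i = j := by simpa using hi
      exact ⟨v, hA⟩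
    choose b hb using h_sets
    let f : Fin k → 𝒮' := fun i ↦ ⟨_, hb i⟩
    have hf : Function.Injective f := by
      intro i j hij
      have hi : (Sum.inr i : V ⊕ Fin k) ∈ (f i : Set (V ⊕ Fin k)) := Or.inr rfl
      rw [hij] at hi
      simpa [f] using hi
    have hbij : Function.Bijective f := hf.bijective_of_nat_card_le (by simpa using hcard)
    refine ⟨b, fun v ↦ ?_⟩
    obtain ⟨A, hA, hv⟩ := hcover.symm ▸ Set.mem_univ (Sum.inl v : V ⊕ Fin k)
    obtain ⟨i, hi⟩ := hbij.surjective ⟨A, hA⟩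
    obtain rfl : _ = A := congrArg Subtype.val hi
    exact ⟨i, by simpa [f] using hv⟩
end

section
/- Let G = (V,E) be a finite simple graph and let v_1, v_2, v_3, v_4 be four pairwise distinct, pairwise nonadjacent vertices that have the same open neighborhood N(v_1) = N(v_2) = N(v_3) = N(v_4) ≠ ∅. Then for every integer k, the graph G admits a burning sequence of length k if and only if the induced subgraph of G on V ∖ {v_4} admits a burning sequence of length k. -/
theorem mem_burnBall_map {V W : Type*} {G : SimpleGraph V} {H : SimpleGraph W} (φ : G →g H)
    {v w : V} {i : ℕ} (h : w ∈ burnBall G v i) : φ w ∈ burnBall H (φ v) i := by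
  obtain ⟨p, hp⟩ := h
  exact ⟨p.map φ, by simpa using hp⟩

theorem IsBurningSeq.comp_of_surjective {V W : Type*} {G : SimpleGraph V} {H : SimpleGraph W}
    (φ : G →g H) (hφ : Function.Surjective φ) {k : ℕ} {b : Fin k → V} (hb : IsBurningSeq G b) :
    IsBurningSeq H (φ ∘ b) := by
  intro w
  obtain ⟨v, rfl⟩ := hφ w
  obtain ⟨i, hi⟩ := hb v
  exact ⟨i, mem_burnBall_map φ hi⟩

/-- A ball that contains a vertex `v` contains every false twin of `v`, unless it is centered
at `v` and has radius at most `1`. -/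
theorem mem_burnBall_twin {V : Type*} {G : SimpleGraph V} {a v w : V}
    (hN : G.neighborSet v = G.neighborSet w) (hne : (G.neighborSet v).Nonempty)
    {i : ℕ} (h : v ∈ burnBall G a i) : w ∈ burnBall G a i ∨ (a = v ∧ i < 2) := by
  have hadj (x : V) (hx : G.Adj v x) : G.Adj w x := hN.subset hx
  obtain ⟨p, hp⟩ := h
  rw [← SimpleGraph.Walk.length_reverse] at hp
  generalize p.reverse = r at hp
  cases r with
  | nil =>
    by_cases hi : i < 2
    · exact Or.inr ⟨rfl, hi⟩
    · obtain ⟨x, hx : G.Adj a x⟩ := hne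
      refine Or.inl ⟨.cons hx (.cons (hadj x hx).symm .nil), ?_⟩
      simp only [SimpleGraph.Walk.length_cons, SimpleGraph.Walk.length_nil]
      omega
  | cons hx q =>
    refine Or.inl ⟨(SimpleGraph.Walk.cons (hadj _ hx) q).reverse, ?_⟩
    simpa using hp

open Classical in
/-- Folding `w` onto its false twin `v` is a homomorphism to the graph without `w`. -/
noncomputable def foldTwin {V : Type*} (G : SimpleGraph V) {v w : V} (hvw : v ≠ w)
    (hN : G.neighborSet v = G.neighborSet w) : G →g G.induce ({w}ᶜ : Set V) where
  toFun x := if h : x = w then ⟨v, hvw⟩ else ⟨x, h⟩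
  map_rel' {x y} hxy := by
    have hadj (z : V) : G.Adj v z ↔ G.Adj w z := Set.ext_iff.mp hN z
    by_cases hx : x = w <;> by_cases hy : y = w
    · subst hx hy
      exact absurd hxy (G.loopless.irrefl _)
    · subst hx
      simpa [hy, hadj] using hxy
    · subst hy
      simpa [hx, G.adj_comm x, hadj] using hxy
    · simpa [hx, hy] using hxy

theorem foldTwin_surjective {V : Type*} (G : SimpleGraph V) {v w : V} (hvw : v ≠ w)
    (hN : G.neighborSet v = G.neighborSet w) : Function.Surjective (foldTwin G hvw hN) :=
  fun x => ⟨x, dif_neg x.2⟩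

/-- If `v₁, v₂, v₃, v₄` are pairwise distinct, pairwise nonadjacent vertices with the same
nonempty open neighborhood, then `G` has a burning sequence of length `k` iff the induced
subgraph on `V \ {v₄}` does. -/
theorem burning_remove_false_twin {V : Type*} [Fintype V] (G : SimpleGraph V)
    (v₁ v₂ v₃ v₄ : V)
    (h12 : v₁ ≠ v₂) (h13 : v₁ ≠ v₃) (h14 : v₁ ≠ v₄)
    (h23 : v₂ ≠ v₃) (h24 : v₂ ≠ v₄) (h34 : v₃ ≠ v₄)
    (a12 : ¬ G.Adj v₁ v₂) (a13 : ¬ G.Adj v₁ v₃) (a14 : ¬ G.Adj v₁ v₄)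
    (a23 : ¬ G.Adj v₂ v₃) (a24 : ¬ G.Adj v₂ v₄) (a34 : ¬ G.Adj v₃ v₄)
    (hN12 : G.neighborSet v₁ = G.neighborSet v₂)
    (hN13 : G.neighborSet v₁ = G.neighborSet v₃)
    (hN14 : G.neighborSet v₁ = G.neighborSet v₄)
    (hNne : (G.neighborSet v₁).Nonempty)
    (k : ℕ) :
    (∃ b : Fin k → V, IsBurningSeq G b) ↔
      (∃ b : Fin k → ({v₄}ᶜ : Set V),
        IsBurningSeq (G.induce ({v₄}ᶜ : Set V)) b) := by
  constructor
  · rintro ⟨b, hb⟩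
    exact ⟨_, hb.comp_of_surjective _ (foldTwin_surjective G h14 hN14)⟩
  · rintro ⟨b, hb⟩
    refine ⟨fun i => (b i : V), ?_⟩
    have hcov (v : V) (hv : v ≠ v₄) : ∃ i : Fin k, v ∈ burnBall G (b i) (i : ℕ) :=
      (hb ⟨v, hv⟩).imp fun _ hi =>
        mem_burnBall_map (SimpleGraph.Embedding.induce ({v₄}ᶜ : Set V)).toHom hi
    intro v
    by_cases hv : v = v₄
    swap
    · exact hcov v hv
    subst hv
    by_contra! hnot
    have hcenter (u : V) (hu : u ≠ v) (hN : G.neighborSet u = G.neighborSet v) :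
        ∃ i : Fin k, (b i : V) = u ∧ (i : ℕ) < 2 := by
      obtain ⟨i, hi⟩ := hcov u hu
      exact ⟨i, (mem_burnBall_twin hN (by rwa [hN, ← hN14]) hi).resolve_left (hnot i)⟩
    obtain ⟨i₁, e₁, l₁⟩ := hcenter v₁ h14 hN14
    obtain ⟨i₂, e₂, l₂⟩ := hcenter v₂ h24 (hN12.symm.trans hN14)
    obtain ⟨i₃, e₃, l₃⟩ := hcenter v₃ h34 (hN13.symm.trans hN14)
    have n12 : i₁ ≠ i₂ := by rintro rfl; exact h12 (e₁.symm.trans e₂)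
    have n13 : i₁ ≠ i₃ := by rintro rfl; exact h13 (e₁.symm.trans e₃)
    have n23 : i₂ ≠ i₃ := by rintro rfl; exact h23 (e₂.symm.trans e₃)
    omega
end

section
/- Let (U, 𝒮, s) be a Set Cover instance with U = {u_1,…,u_n}, 𝒮 = {S_1,…,S_m} a family of nonempty subsets of U, and s ≥ 1, and let G = G(U,𝒮,s) be the graph of the Set-Cover-to-Graph-Burning construction with k = s+2. Then G admits a burning sequence of length k = s+2 if and only if there exists a subfamily 𝒮' ⊆ 𝒮 with |𝒮'| ≤ s and ⋃_{S ∈ 𝒮'} S = U. -/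
namespace GB

/-- Vertices of the graph `G(U, 𝒮, s)` of the Set-Cover-to-Graph-Burning reduction,
where `U = {u_1,…,u_n}` is identified with `Fin n`, the family `𝒮 = {S_1,…,S_m}` is
indexed by `Fin m`, `k = s + 2`, and the index `i ∈ {2, …, k-1}` is encoded as
`a ∈ Fin s` with `i = a + 2`:
* `base j` is the element `u_{j+1}` of `U` (these form a clique);
* `ucopy a j` is the copy `u_{j+1}^{(a+2)}` in the clique `U_{a+2}`;
* `vcopy a q` is the vertex `v_{q+1}^{(a+2)}` of the independent set `V_{a+2}`;
* `pend a t r` is the `r`-th vertex of the `t`-th of the `(a+2)+2` pendant paths on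
  `a+2` vertices attached to `V_{a+2}` (the endpoint `r = 0` is adjacent to all of
  `V_{a+2}`);
* `inner a j r` is the `r`-th of the `(a+2)-2 = a` internal vertices of the path of
  length `(a+2)-1` joining `ucopy a j` to `base j`;
* `w` is the pendant vertex attached to `u_1 = base 0`, and `x`, `y`, `z` form the path
  `x - y - z` with `x` additionally adjacent to `u_1 = base 0`. -/
inductive Vert (n m s : ℕ) : Type where
  | base : Fin n → Vert n m s
  | ucopy : Fin s → Fin n → Vert n m s
  | vcopy : Fin s → Fin m → Vert n m s
  | pend : (a : Fin s) → Fin ((a : ℕ) + 4) → Fin ((a : ℕ) + 2) → Vert n m s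
  | inner : (a : Fin s) → Fin n → Fin (a : ℕ) → Vert n m s
  | w : Vert n m s
  | x : Vert n m s
  | y : Vert n m s
  | z : Vert n m s

/-- The base (one-directional) adjacency relation of the reduction graph; the graph
itself is its symmetrization `GB.graph`. -/
def rel {n m s : ℕ} (S : Fin m → Finset (Fin n)) : Vert n m s → Vert n m s → Prop
  | .base _, .base _ => True
  | .ucopy a _, .ucopy a' _ => a = a'
  | .ucopy a j, .vcopy a' q => a = a' ∧ j ∈ S q
  | .vcopy a _, .pend a' _ r => a = a' ∧ (r : ℕ) = 0
  | .pend a t r, .pend a' t' r' => a = a' ∧ (t : ℕ) = (t' : ℕ) ∧ (r' : ℕ) = (r : ℕ) + 1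
  | .ucopy a j, .inner a' j' r => a = a' ∧ j = j' ∧ (r : ℕ) = 0
  | .inner a j r, .inner a' j' r' => a = a' ∧ j = j' ∧ (r' : ℕ) = (r : ℕ) + 1
  | .inner a j r, .base j' => j = j' ∧ (r : ℕ) + 1 = (a : ℕ)
  | .ucopy a j, .base j' => j = j' ∧ (a : ℕ) = 0
  | .w, .base j => (j : ℕ) = 0
  | .x, .base j => (j : ℕ) = 0
  | .x, .y => True
  | .y, .z => True
  | _, _ => False

/-- The graph `G(U, 𝒮, s)` of the Set-Cover-to-Graph-Burning reduction. -/
def graph {n m s : ℕ} (S : Fin m → Finset (Fin n)) : SimpleGraph (Vert n m s) :=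
  SimpleGraph.fromRel (rel S)

end GB

section Balls

variable {V : Type*} {G : SimpleGraph V}

theorem self_mem_burnBall (v : V) (i : ℕ) : v ∈ burnBall G v i :=
  ⟨.nil, Nat.zero_le i⟩

theorem burnBall_mono (v : V) {i j : ℕ} (h : i ≤ j) : burnBall G v i ⊆ burnBall G v j :=
  fun _ ⟨p, hp⟩ => ⟨p, hp.trans h⟩

theorem burnBall_succ_of_adj {u v w : V} {i : ℕ} (hv : v ∈ burnBall G u i) (h : G.Adj v w) :
    w ∈ burnBall G u (i + 1) := by
  obtain ⟨p, hp⟩ := hv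
  exact ⟨p.concat h, by simpa using hp⟩

theorem eq_of_mem_burnBall_zero {u v : V} (h : v ∈ burnBall G u 0) : v = u := by
  obtain ⟨p, hp⟩ := h
  exact (SimpleGraph.Walk.eq_of_length_eq_zero (Nat.le_zero.mp hp)).symm

theorem eq_or_adj_of_mem_burnBall_one {u v : V} (h : v ∈ burnBall G u 1) : v = u ∨ G.Adj u v := by
  obtain ⟨p, hp⟩ := h
  rcases Nat.le_one_iff_eq_zero_or_eq_one.mp hp with h0 | h1
  · exact .inl (SimpleGraph.Walk.eq_of_length_eq_zero h0).symm
  · exact .inr (SimpleGraph.Walk.adj_of_length_eq_one h1)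

/-- A function that grows by at most one along each edge grows by at most `i` on a ball of
radius `i`. -/
theorem le_add_of_mem_burnBall {f : V → ℕ} (hf : ∀ u v, G.Adj u v → f v ≤ f u + 1)
    {u v : V} {i : ℕ} (h : v ∈ burnBall G u i) : f v ≤ f u + i := by
  obtain ⟨p, hp⟩ := h
  have key : f v ≤ f u + p.length := by
    clear hp
    induction p with
    | nil => simp
    | cons h _ ih =>
      have := hf _ _ h
      simp only [SimpleGraph.Walk.length_cons]
      omega
  omega

end Balls

namespace GB

variable {n m s : ℕ} {S : Fin m → Finset (Fin n)}

theorem graph_adj {u v : Vert n m s} :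
    (graph S).Adj u v ↔ u ≠ v ∧ (rel S u v ∨ rel S v u) :=
  SimpleGraph.fromRel_adj _ _ _

theorem burnBall_succ_of_rel {u v v' : Vert n m s} {i : ℕ} (hv : v ∈ burnBall (graph S) u i)
    (h : rel S v v' ∨ rel S v' v) : v' ∈ burnBall (graph S) u (i + 1) := by
  by_cases hvw : v = v'
  · exact hvw ▸ burnBall_mono u i.le_succ hv
  · exact burnBall_succ_of_adj hv (graph_adj.mpr ⟨hvw, h⟩)

theorem le_add_one_of_adj {f : Vert n m s → ℕ}
    (hf : ∀ u v, rel S u v → f u ≤ f v + 1 ∧ f v ≤ f u + 1) (u v : Vert n m s)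
    (h : (graph S).Adj u v) : f v ≤ f u + 1 := by
  rcases (graph_adj.mp h).2 with h | h
  · exact (hf _ _ h).2
  · exact (hf _ _ h).1

section Center

variable (S) (a : Fin s) (q : Fin m)

theorem pend_mem_burnBall_vcopy (t : Fin ((a : ℕ) + 4)) (r : Fin ((a : ℕ) + 2)) :
    Vert.pend a t r ∈ burnBall (graph S) (.vcopy a q) (r + 1) := by
  obtain ⟨r, hr⟩ := r
  induction r with
  | zero => exact burnBall_succ_of_rel (self_mem_burnBall _ 0) (.inl ⟨rfl, rfl⟩)
  | succ r ih => exact burnBall_succ_of_rel (ih (by omega)) (.inl ⟨rfl, rfl, rfl⟩)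

theorem vcopy_mem_burnBall_vcopy (q' : Fin m) :
    Vert.vcopy a q' ∈ burnBall (graph S) (.vcopy a q) 2 :=
  burnBall_succ_of_rel (pend_mem_burnBall_vcopy S a q 0 0) (.inr ⟨rfl, rfl⟩)

variable {a q}

theorem ucopy_mem_burnBall_vcopy_of_mem {j : Fin n} (hj : j ∈ S q) :
    Vert.ucopy a j ∈ burnBall (graph S) (.vcopy a q) 1 :=
  burnBall_succ_of_rel (self_mem_burnBall _ 0) (.inr ⟨rfl, hj⟩)

theorem ucopy_mem_burnBall_vcopy (hq : (S q).Nonempty) (j : Fin n) :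
    Vert.ucopy a j ∈ burnBall (graph S) (.vcopy a q) 2 := by
  obtain ⟨j', hj'⟩ := hq
  refine burnBall_succ_of_rel (ucopy_mem_burnBall_vcopy_of_mem S hj') (.inl ?_)
  simp [rel]

theorem inner_mem_burnBall {u : Vert n m s} {j : Fin n} {i : ℕ}
    (h : Vert.ucopy a j ∈ burnBall (graph S) u i) (r : Fin (a : ℕ)) :
    Vert.inner a j r ∈ burnBall (graph S) u (i + r + 1) := by
  obtain ⟨r, hr⟩ := r
  induction r with
  | zero => exact burnBall_succ_of_rel h (.inl ⟨rfl, rfl, rfl⟩)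
  | succ r ih => exact burnBall_succ_of_rel (ih (by omega)) (.inl ⟨rfl, rfl, rfl⟩)

theorem base_mem_burnBall {u : Vert n m s} {j : Fin n} {i : ℕ}
    (h : Vert.ucopy a j ∈ burnBall (graph S) u i) :
    Vert.base j ∈ burnBall (graph S) u (i + a + 1) := by
  by_cases ha : (a : ℕ) = 0
  · exact burnBall_mono _ (by omega) (burnBall_succ_of_rel h (.inl ⟨rfl, ha⟩))
  · have hr := inner_mem_burnBall S h ⟨a - 1, by omega⟩
    refine burnBall_mono _ ?_ (burnBall_succ_of_rel hr (.inl ⟨rfl, ?_⟩)) <;> dsimp only <;> omega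

end Center

section Potential

variable (S)

/-- A lower bound for the distance from `vcopy c q`, truncated at `c + 3`. -/
def centerPotential (c : Fin s) (q : Fin m) : Vert n m s → ℕ
  | .base j => if j ∈ S q then c + 2 else c + 3
  | .ucopy a j => if a = c then (if j ∈ S q then 1 else 2) else c + 3
  | .vcopy a q' => if a = c then (if q' = q then 0 else 2) else c + 3
  | .pend a _ _ => if a = c then 1 else c + 3
  | .inner a j r => if a = c then (if j ∈ S q then r + 2 else r + 3) else c + 3
  | .w => c + 3
  | .x => c + 3
  | .y => c + 3
  | .z => c + 3

/-- The depth of a vertex in the `t`-th pendant path of level `a`: the vertices of `V_{a+2}`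
have depth one and every vertex outside of these has depth zero. -/
def pendPotential (a : Fin s) (t : ℕ) : Vert n m s → ℕ
  | .vcopy a' _ => if a' = a then 1 else 0
  | .pend a' t' r => if a' = a ∧ (t' : ℕ) = t then r + 2 else 0
  | _ => 0

theorem centerPotential_rel (c : Fin s) (q : Fin m) (u v : Vert n m s) (h : rel S u v) :
    centerPotential S c q u ≤ centerPotential S c q v + 1 ∧
      centerPotential S c q v ≤ centerPotential S c q u + 1 := by
  cases u <;> cases v <;> simp only [rel, centerPotential] at h ⊢ <;> grind

theorem pendPotential_rel (a : Fin s) (t : ℕ) (u v : Vert n m s) (h : rel S u v) :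
    pendPotential a t u ≤ pendPotential a t v + 1 ∧
      pendPotential a t v ≤ pendPotential a t u + 1 := by
  cases u <;> cases v <;> simp only [rel, pendPotential] at h ⊢ <;> grind

variable {S}

theorem centerPotential_le {c : Fin s} {q : Fin m} {v : Vert n m s}
    (h : v ∈ burnBall (graph S) (.vcopy c q) (c + 2)) : centerPotential S c q v ≤ c + 2 := by
  simpa [centerPotential] using
    le_add_of_mem_burnBall (le_add_one_of_adj (centerPotential_rel S c q)) h

theorem le_pendPotential_add {a : Fin s} {t : ℕ} {u v : Vert n m s} {i : ℕ}
    (h : v ∈ burnBall (graph S) u i) : pendPotential a t v ≤ pendPotential a t u + i :=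
  le_add_of_mem_burnBall (le_add_one_of_adj (pendPotential_rel S a t)) h

end Potential

/-- In a burning sequence, if all sources of index above `a + 2` lie in their own level, then
some pendant path of level `a` contains no source. -/
theorem exists_pend_free (b : Fin (s + 2) → Vert n m s) (a : Fin s)
    (hb : ∀ c : Fin s, a < c → ∃ q, b ⟨c + 2, by omega⟩ = .vcopy c q) :
    ∃ t : Fin ((a : ℕ) + 4), ∀ i r, b i ≠ .pend a t r := by
  by_contra! hcon
  choose g r hg using hcon
  have hlt : ∀ t, (g t : ℕ) < a + 3 := by
    intro t
    by_contra! hle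
    obtain ⟨q, hq⟩ := hb ⟨g t - 2, by omega⟩ (Fin.lt_def.mpr (by dsimp only; omega))
    have : (⟨(g t : ℕ) - 2 + 2, by omega⟩ : Fin (s + 2)) = g t := Fin.ext (by dsimp only; omega)
    rw [this, hg] at hq
    cases hq
  have hinj : Function.Injective fun t => (⟨g t, hlt t⟩ : Fin (a + 3)) := by
    intro t t' htt
    have hgg : g t = g t' := Fin.ext (Fin.mk.inj_iff.mp htt)
    have := hg t
    rw [hgg, hg] at this
    injection this with _ h
    exact h.symm
  simpa using Fintype.card_le_of_injective _ hinj

theorem exists_source_eq_vcopy {b : Fin (s + 2) → Vert n m s} (hb : IsBurningSeq (graph S) b)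
    (a : Fin s) : ∃ q, b ⟨a + 2, by omega⟩ = .vcopy a q := by
  induction h : s - (a : ℕ) using Nat.strong_induction_on generalizing a with
  | _ d ih =>
    have habove : ∀ c : Fin s, a < c → ∃ q, b ⟨c + 2, by omega⟩ = .vcopy c q :=
      fun c hc => ih (s - c) (by have := Fin.lt_def.mp hc; omega) c rfl
    obtain ⟨t, ht⟩ := exists_pend_free b a habove
    obtain ⟨i, hi⟩ := hb (.pend a t ⟨a + 1, by omega⟩)
    have hpot := le_pendPotential_add (a := a) (t := t) hi
    have hleaf : pendPotential a t (.pend a t ⟨a + 1, by omega⟩ : Vert n m s) = a + 3 := by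
      simp [pendPotential]
    have hfree : pendPotential a t (b i) ≤ 1 := by
      cases hbi : b i with
      | pend a' t' r =>
        have : ¬ (a' = a ∧ (t' : ℕ) = t) := by
          rintro ⟨rfl, htt⟩
          obtain rfl : t' = t := Fin.ext htt
          exact ht i r hbi
        simp [pendPotential, this]
      | vcopy a' _ => simp only [pendPotential]; split_ifs <;> omega
      | _ => simp [pendPotential]
    rcases Nat.lt_or_ge (a + 2) (i : ℕ) with hlt | hle
    · have hlt' : a < (⟨i - 2, by omega⟩ : Fin s) := Fin.lt_def.mpr (by dsimp only; omega)
      obtain ⟨q, hq⟩ := habove _ hlt'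
      have hii : (⟨(i : ℕ) - 2 + 2, by omega⟩ : Fin (s + 2)) = i :=
        Fin.ext (by dsimp only; omega)
      rw [hii] at hq
      rw [hq] at hi
      have := centerPotential_le (burnBall_mono _ (by dsimp only; omega) hi)
      simp [centerPotential, hlt'.ne] at this
    · have hia : (⟨a + 2, by omega⟩ : Fin (s + 2)) = i := Fin.ext (by dsimp only; omega)
      rw [hia]
      have hpos : pendPotential a t (b i) = 1 := by omega
      cases hbi : b i with
      | vcopy a' q =>
        rw [hbi] at hpos
        simp only [pendPotential] at hpos
        obtain rfl : a' = a := by by_contra hne; simp [hne] at hpos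
        exact ⟨q, rfl⟩
      | pend a' t' r =>
        rw [hbi] at hpos
        simp only [pendPotential] at hpos
        split_ifs at hpos
        omega
      | _ => simp [hbi, pendPotential] at hpos

theorem mem_burnBall_zero_or_one_of_forall_not {b : Fin (s + 2) → Vert n m s}
    (hb : IsBurningSeq (graph S) b) {v : Vert n m s}
    (hv : ∀ a : Fin s, v ∉ burnBall (graph S) (b ⟨a + 2, by omega⟩) (a + 2)) :
    v = b 0 ∨ v = b 1 ∨ (graph S).Adj (b 1) v := by
  obtain ⟨⟨i, hi⟩, hvi⟩ := hb v
  match i, hi, hvi with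
  | 0, _, hvi => exact .inl (eq_of_mem_burnBall_zero hvi)
  | 1, _, hvi => exact .inr (eq_or_adj_of_mem_burnBall_one hvi)
  | i + 2, hi, hvi => exact (hv ⟨i, by omega⟩ hvi).elim

theorem eq_w_and_eq_y {u v : Vert n m s}
    (hw : .w = u ∨ .w = v ∨ (graph S).Adj v .w) (hx : .x = u ∨ .x = v ∨ (graph S).Adj v .x)
    (hy : .y = u ∨ .y = v ∨ (graph S).Adj v .y) (hz : .z = u ∨ .z = v ∨ (graph S).Adj v .z) :
    u = .w ∧ v = .y := by
  cases v <;> simp [graph_adj, rel] at hw hx hy hz <;> grind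

theorem exists_cover_of_isBurningSeq {b : Fin (s + 2) → Vert n m s}
    (hb : IsBurningSeq (graph S) b) :
    ∃ 𝒮' : Finset (Fin m), 𝒮'.card ≤ s ∧ ∀ j : Fin n, ∃ q ∈ 𝒮', j ∈ S q := by
  choose q hq using exists_source_eq_vcopy hb
  refine ⟨Finset.univ.image q, Finset.card_image_le.trans (by simp), fun j => ?_⟩
  have tail {v : Vert n m s} (hv : ∀ a : Fin s, (a : ℕ) + 2 < centerPotential S a (q a) v) :=
    mem_burnBall_zero_or_one_of_forall_not hb fun a ha =>
      (hv a).not_ge (centerPotential_le (hq a ▸ ha))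
  obtain ⟨h0, h1⟩ := eq_w_and_eq_y (tail (v := .w) (by simp [centerPotential]))
    (tail (v := .x) (by simp [centerPotential])) (tail (v := .y) (by simp [centerPotential]))
    (tail (v := .z) (by simp [centerPotential]))
  by_contra! hj
  have := tail (v := .base j) fun a => by simp [centerPotential, hj (q a) (by simp)]
  rw [h0, h1] at this
  simp [graph_adj, rel] at this

theorem isBurningSeq_of_cover (hS : ∀ q, (S q).Nonempty) (q : Fin s → Fin m)
    (hq : ∀ j, ∃ a, j ∈ S (q a)) :
    IsBurningSeq (graph S) (Fin.cons .w (Fin.cons .y fun a => .vcopy a (q a)) :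
      Fin (s + 2) → Vert n m s) := by
  have hcenter {v : Vert n m s} (a : Fin s) {i : ℕ} (hi : i ≤ a + 2)
      (h : v ∈ burnBall (graph S) (.vcopy a (q a)) i) :
      ∃ i : Fin (s + 2), v ∈ burnBall (graph S)
        ((Fin.cons .w (Fin.cons .y fun a => .vcopy a (q a)) : Fin (s + 2) → Vert n m s) i) i :=
    ⟨a.succ.succ, burnBall_mono _ (by simpa using hi) (by simpa using h)⟩
  intro v
  cases v with
  | base j =>
    obtain ⟨a, ha⟩ := hq j
    exact hcenter a (by omega) (base_mem_burnBall S (ucopy_mem_burnBall_vcopy_of_mem S ha))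
  | ucopy a j => exact hcenter a (by omega) (ucopy_mem_burnBall_vcopy S (hS _) j)
  | vcopy a q' => exact hcenter a (by omega) (vcopy_mem_burnBall_vcopy S a _ q')
  | pend a t r => exact hcenter a (by omega) (pend_mem_burnBall_vcopy S a _ t r)
  | inner a j r =>
    exact hcenter a (by omega) (inner_mem_burnBall S (ucopy_mem_burnBall_vcopy S (hS _) j) r)
  | w => exact ⟨0, self_mem_burnBall _ _⟩
  | x => exact ⟨1, burnBall_succ_of_rel (i := 0) (self_mem_burnBall _ _) (.inr trivial)⟩
  | y => exact ⟨1, self_mem_burnBall _ _⟩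
  | z => exact ⟨1, burnBall_succ_of_rel (i := 0) (self_mem_burnBall _ _) (.inl trivial)⟩

end GB

/-- A nonempty finite set with at most `s` elements is enumerated by `Fin s`. -/
theorem Finset.exists_fin_enumeration {α : Type*} {s : ℕ} {T : Finset α} (hT : T.Nonempty)
    (hs : T.card ≤ s) : ∃ f : Fin s → α, ∀ a ∈ T, ∃ i, f i = a := by
  obtain ⟨d, -⟩ := hT
  refine ⟨fun i => T.toList.getD i d, fun a ha => ?_⟩
  obtain ⟨i, hi, rfl⟩ := List.mem_iff_getElem.mp (Finset.mem_toList.mpr ha)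
  rw [Finset.length_toList] at hi
  exact ⟨⟨i, hi.trans_le hs⟩, by simp [hi]⟩

/-- Correctness of the Set-Cover-to-Graph-Burning reduction: with `k = s + 2`, the graph
`G(U, 𝒮, s)` admits a burning sequence of length `k` iff the Set Cover instance
`(U, 𝒮, s)` has a cover of size at most `s`. -/
theorem setCover_iff_burning (n m s : ℕ) (hn : 0 < n) (hs : 1 ≤ s)
    (S : Fin m → Finset (Fin n)) (hSne : ∀ q : Fin m, (S q).Nonempty) :
    (∃ b : Fin (s + 2) → GB.Vert n m s, IsBurningSeq (GB.graph S) b) ↔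
      ∃ 𝒮' : Finset (Fin m), 𝒮'.card ≤ s ∧ ∀ j : Fin n, ∃ q ∈ 𝒮', j ∈ S q := by
  constructor
  · rintro ⟨b, hb⟩
    exact GB.exists_cover_of_isBurningSeq hb
  · rintro ⟨𝒮', hcard, hcover⟩
    obtain ⟨q₀, hq₀, -⟩ := hcover ⟨0, hn⟩
    obtain ⟨f, hf⟩ := Finset.exists_fin_enumeration ⟨q₀, hq₀⟩ hcard
    refine ⟨_, GB.isBurningSeq_of_cover hSne f fun j => ?_⟩
    obtain ⟨q, hq, hj⟩ := hcover j
    obtain ⟨a, rfl⟩ := hf q hq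
    exact ⟨a, hj⟩
end
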